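/- For 2 ≤ c ≤ n², the maximum of m(B) over all n×n boards B with at most c colours satisfies (√(c-1)·n − c)/2 ≤ max m(B) ≤ 2n + √(2c)·n + c; in particular this maximum is Θ(√c · n). -/

import Mathlib

/-- Tiles of an `n × n` board. -/
abbrev Tile (n : ℕ) := Fin n × Fin n

/-- Two tiles are adjacent if they differ by a unit step (horizontally or vertically). -/
def adjT {n : ℕ} (p q : Tile n) : Prop :=
  ((p.1 : ℤ) - (q.1 : ℤ)).natAbs + ((p.2 : ℤ) - (q.2 : ℤ)).natAbs = 1

/-- A board assigns one of `c` colours to each tile. -/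
abbrev Board (n c : ℕ) := Tile n → Fin c

/-- `SameColorConn B p q` : `q` is in the monochromatic connected region of `B`
containing `p`. -/
def SameColorConn {n c : ℕ} (B : Board n c) (p q : Tile n) : Prop :=
  Relation.ReflTransGen (fun a b => adjT a b ∧ B a = B b) p q

open Classical in
/-- A Flood-It move: recolour the monochromatic region containing `o` with colour `k`. -/
noncomputable def flood {n c : ℕ} (B : Board n c) (o : Tile n) (k : Fin c) : Board n c :=
  fun p => if SameColorConn B o p then k else B p

/-- Play a sequence of Flood-It moves (flooding from `o`). -/
noncomputable def playMoves {n c : ℕ} (o : Tile n) : Board n c → List (Fin c) → Board n c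
  | B, [] => B
  | B, k :: ks => playMoves o (flood B o k) ks

/-- A board is flooded when it is monochromatic. -/
def Flooded {n c : ℕ} (B : Board n c) : Prop := ∀ p q : Tile n, B p = B q

/-- `floodMoves B o` : the minimum number of moves (flooding from `o`) needed to
flood the board `B`. -/
noncomputable def floodMoves {n c : ℕ} (B : Board n c) (o : Tile n) : ℕ :=
  sInf {l : ℕ | ∃ ms : List (Fin c), ms.length = l ∧ Flooded (playMoves o B ms)}

section Flooding

variable {n c : ℕ} {o : Tile n} {B B' : Board n c}

theorem SameColorConn.eq_color {p q : Tile n} (h : SameColorConn B p q) : B p = B q := by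
  induction h with
  | refl => rfl
  | tail _ hbc ih => exact ih.trans hbc.2

theorem flood_of_conn {q : Tile n} (k : Fin c) (h : SameColorConn B o q) :
    flood B o k q = k := by
  simp [flood, h]

theorem flood_of_not_conn {q : Tile n} (k : Fin c) (h : ¬ SameColorConn B o q) :
    flood B o k q = B q := by
  simp [flood, h]

theorem SameColorConn.flood {q : Tile n} (k : Fin c) (h : SameColorConn B o q) :
    SameColorConn (flood B o k) o q := by
  induction h with
  | refl => exact Relation.ReflTransGen.refl
  | tail hab hbc ih =>
    exact ih.tail ⟨hbc.1, by rw [flood_of_conn k hab, flood_of_conn k (hab.tail hbc)]⟩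

theorem SameColorConn.flood_adj {p q : Tile n} (h : SameColorConn B o p) (hpq : adjT p q) :
    SameColorConn (_root_.flood B o (B q)) o q := by
  refine (h.flood (B q)).tail ⟨hpq, ?_⟩
  rw [flood_of_conn _ h]
  by_cases hq : SameColorConn B o q
  · rw [flood_of_conn _ hq]
  · rw [flood_of_not_conn _ hq]

/-- Outside the region of `o`, the board `B'` still has the colours of `B`. -/
def AgreeOutside (o : Tile n) (B B' : Board n c) : Prop :=
  ∀ p, ¬ SameColorConn B' o p → B' p = B p

theorem AgreeOutside.flood (h : AgreeOutside o B B') (k : Fin c) :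
    AgreeOutside o B (flood B' o k) := by
  intro p hp
  have hp' : ¬ SameColorConn B' o p := fun h' => hp (h'.flood k)
  rw [flood_of_not_conn k hp', h p hp']

theorem AgreeOutside.conn_flood {p q : Tile n} (h : AgreeOutside o B B')
    (hp : SameColorConn B' o p) (hpq : adjT p q) :
    SameColorConn (_root_.flood B' o (B q)) o q := by
  by_cases hq : SameColorConn B' o q
  · exact hq.flood _
  · rw [← h q hq]
    exact hp.flood_adj hpq

theorem playMoves_append (ms ms' : List (Fin c)) (B : Board n c) :
    playMoves o B (ms ++ ms') = playMoves o (playMoves o B ms) ms' := by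
  induction ms generalizing B with
  | nil => rfl
  | cons k ks ih => exact ih _

theorem SameColorConn.playMoves {q : Tile n} (ms : List (Fin c)) (h : SameColorConn B o q) :
    SameColorConn (playMoves o B ms) o q := by
  induction ms generalizing B with
  | nil => exact h
  | cons k ks ih => exact ih (h.flood k)

theorem AgreeOutside.playMoves (h : AgreeOutside o B B') (ms : List (Fin c)) :
    AgreeOutside o B (playMoves o B' ms) := by
  induction ms generalizing B' with
  | nil => exact h
  | cons k ks ih => exact ih (h.flood k)

theorem AgreeOutside.refl (o : Tile n) (B : Board n c) : AgreeOutside o B B := fun _ _ => rfl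

/-- Some sequence of `N` moves brings all of `S` into the region of `o`. -/
def CanReach (o : Tile n) (B : Board n c) (N : ℕ) (S : Set (Tile n)) : Prop :=
  ∃ ms : List (Fin c), ms.length = N ∧ ∀ q ∈ S, SameColorConn (playMoves o B ms) o q

theorem CanReach.path {N : ℕ} {S : Set (Tile n)} (h : CanReach o B N S) (f : ℕ → Tile n)
    (h0 : f 0 ∈ S) (hf : ∀ j, f (j + 1) = f j ∨ adjT (f j) (f (j + 1))) (M : ℕ) :
    CanReach o B (N + M) (S ∪ f '' Set.Iic M) := by
  induction M with
  | zero =>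
    obtain ⟨ms, hl, hS⟩ := h
    refine ⟨ms, hl, ?_⟩
    rintro q (hq | ⟨j, hj, rfl⟩)
    · exact hS q hq
    · rw [Set.mem_Iic, Nat.le_zero] at hj
      exact hS _ (hj ▸ h0)
  | succ M ih =>
    obtain ⟨ms, hl, hS⟩ := ih
    refine ⟨ms ++ [B (f (M + 1))], by simp [hl, Nat.add_assoc], ?_⟩
    rw [playMoves_append]
    rintro q (hq | ⟨j, hj, rfl⟩)
    · exact (hS q (Or.inl hq)).playMoves _
    · have hM := hS (f M) (Or.inr ⟨M, Set.mem_Iic.2 le_rfl, rfl⟩)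
      rcases Nat.lt_or_ge M j with hlt | hle
      · obtain rfl : j = M + 1 := le_antisymm hj hlt
        rcases hf M with he | ha
        · rw [he]
          exact hM.playMoves _
        · exact ((AgreeOutside.refl o B).playMoves ms).conn_flood hM ha
      · exact (hS (f j) (Or.inr ⟨j, hle, rfl⟩)).playMoves _

theorem CanReach.all_colors {N : ℕ} {S : Set (Tile n)} (h : CanReach o B N S) :
    CanReach o B (N + c) (S ∪ {q | ∃ p ∈ S, adjT p q}) := by
  obtain ⟨ms, hl, hS⟩ := h
  refine ⟨ms ++ List.finRange c, by simp [hl], ?_⟩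
  rw [playMoves_append]
  rintro q (hq | ⟨p, hp, hpq⟩)
  · exact (hS q hq).playMoves _
  · obtain ⟨l₁, l₂, hl₁₂⟩ := List.append_of_mem (List.mem_finRange (B q))
    rw [hl₁₂, playMoves_append]
    exact SameColorConn.playMoves l₂
      ((((AgreeOutside.refl o B).playMoves ms).playMoves l₁).conn_flood
        ((hS p hp).playMoves l₁) hpq)

theorem CanReach.mono {N : ℕ} {S T : Set (Tile n)} (h : CanReach o B N S) (hT : T ⊆ S) :
    CanReach o B N T := by
  obtain ⟨ms, hl, hS⟩ := h
  exact ⟨ms, hl, fun q hq => hS q (hT hq)⟩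

theorem CanReach.flooded {N : ℕ} (h : CanReach o B N Set.univ) :
    ∃ ms : List (Fin c), ms.length = N ∧ Flooded (playMoves o B ms) := by
  obtain ⟨ms, hl, hS⟩ := h
  exact ⟨ms, hl, fun p q =>
    (hS p (Set.mem_univ p)).eq_color.symm.trans (hS q (Set.mem_univ q)).eq_color⟩

theorem CanReach.vertical {N : ℕ} {S : Set (Tile n)} (h : CanReach o B N S) (d : ℕ) :
    CanReach o B (N + d * c)
      {q | ∃ p ∈ S, p.2 = q.2 ∧ ((p.1 : ℤ) - (q.1 : ℤ)).natAbs ≤ d} := by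
  induction d with
  | zero =>
    rw [Nat.zero_mul, Nat.add_zero]
    refine h.mono ?_
    rintro ⟨q₁, q₂⟩ ⟨⟨p₁, p₂⟩, hp, h2, h1⟩
    obtain rfl : p₂ = q₂ := h2
    obtain rfl : p₁ = q₁ := by
      simp only [Nat.le_zero] at h1
      exact Fin.ext (by omega)
    exact hp
  | succ d ih =>
    have := ih.all_colors
    rw [Nat.add_assoc, ← Nat.succ_mul] at this
    refine this.mono ?_
    rintro ⟨q₁, q₂⟩ ⟨⟨p₁, p₂⟩, hp, h2, h1⟩
    obtain rfl : p₂ = q₂ := h2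
    simp only at h1
    by_cases hd : ((p₁ : ℤ) - (q₁ : ℤ)).natAbs ≤ d
    · exact Or.inl ⟨(p₁, p₂), hp, rfl, hd⟩
    · right
      rcases Nat.lt_or_ge p₁ q₁ with hlt | hge
      · refine ⟨(⟨q₁ - 1, by omega⟩, p₂), ⟨(p₁, p₂), hp, rfl, ?_⟩, ?_⟩
        · simp only; omega
        · simp only [adjT]; omega
      · refine ⟨(⟨q₁ + 1, by omega⟩, p₂), ⟨(p₁, p₂), hp, rfl, ?_⟩, ?_⟩
        · simp only; omega
        · simp only [adjT]; omega

theorem canReach_rows (hn : 0 < n) (B : Board n c) (r : ℕ → Fin n) (k : ℕ) :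
    CanReach (⟨0, hn⟩, ⟨0, hn⟩) B (n + k * n)
      ({q | q.2 = ⟨0, hn⟩} ∪ {q | ∃ j < k, q.1 = r j}) := by
  induction k with
  | zero =>
    have h₀ : CanReach (⟨0, hn⟩, ⟨0, hn⟩) B 0 {(⟨0, hn⟩, ⟨0, hn⟩)} := by
      refine ⟨[], rfl, ?_⟩
      rintro q rfl
      exact Relation.ReflTransGen.refl
    have h₁ := h₀.path (fun j => (⟨min j (n - 1), by omega⟩, ⟨0, hn⟩)) (by simp) (by
      intro j
      by_cases hj : j + 1 ≤ n - 1
      · right; simp only [adjT]; omega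
      · left; simp only [Prod.mk.injEq, Fin.mk.injEq, and_true]; omega) n
    rw [Nat.zero_mul, Nat.add_zero]
    rw [Nat.zero_add] at h₁
    refine h₁.mono ?_
    rintro ⟨q₁, q₂⟩ (hq | ⟨j, hj, _⟩)
    · obtain rfl : q₂ = ⟨0, hn⟩ := hq
      refine Or.inr ⟨q₁, ?_, ?_⟩
      · simp only [Set.mem_Iic]; omega
      · simp only [Prod.mk.injEq, Fin.ext_iff, and_true]; omega
    · omega
  | succ k ih =>
    have h₁ := ih.path (fun j => (r k, ⟨min j (n - 1), by omega⟩)) (by simp) (by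
      intro j
      by_cases hj : j + 1 ≤ n - 1
      · right; simp only [adjT]; omega
      · left; simp only [Prod.mk.injEq, Fin.mk.injEq, true_and]; omega) n
    rw [Nat.add_assoc, ← Nat.succ_mul] at h₁
    refine h₁.mono ?_
    rintro ⟨q₁, q₂⟩ (hq | ⟨j, hj, hq⟩)
    · exact Or.inl (Or.inl hq)
    · obtain rfl : q₁ = r j := hq
      rcases Nat.lt_succ_iff_lt_or_eq.1 hj with hlt | rfl
      · exact Or.inl (Or.inr ⟨j, hlt, rfl⟩)
      · refine Or.inr ⟨q₂, ?_, ?_⟩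
        · simp only [Set.mem_Iic]; omega
        · simp only [Prod.mk.injEq, Fin.ext_iff, true_and]; omega

/-- Flood the first column, then rows spaced `2 * d + 1` apart, then cycle `d` times through all
colours. -/
theorem exists_flooding (hn : 0 < n) (B : Board n c) (d : ℕ) :
    ∃ ms : List (Fin c), ms.length = n + (n / (2 * d + 1) + 1) * n + d * c ∧
      Flooded (playMoves (⟨0, hn⟩, ⟨0, hn⟩) B ms) := by
  have h := (canReach_rows hn B
    (fun j => ⟨min (n - 1) (d + j * (2 * d + 1)), by omega⟩) (n / (2 * d + 1) + 1)).vertical d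
  refine (h.mono ?_).flooded
  rintro ⟨q₁, q₂⟩ -
  have hle : (q₁ : ℕ) / (2 * d + 1) ≤ n / (2 * d + 1) := Nat.div_le_div_right q₁.2.le
  refine ⟨(_, q₂), Or.inr ⟨(q₁ : ℕ) / (2 * d + 1), Nat.lt_succ_of_le hle, rfl⟩, rfl, ?_⟩
  have h₁ := Nat.div_add_mod (q₁ : ℕ) (2 * d + 1)
  have h₂ := Nat.mod_lt (q₁ : ℕ) (show 0 < 2 * d + 1 by omega)
  rw [Nat.mul_comm] at h₁
  have h₃ := q₁.2
  simp only
  generalize (q₁ : ℕ) / (2 * d + 1) * (2 * d + 1) = t at *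
  omega

theorem floodMoves_le (hn : 0 < n) (B : Board n c) (d : ℕ) :
    floodMoves B (⟨0, hn⟩, ⟨0, hn⟩) ≤ n + (n / (2 * d + 1) + 1) * n + d * c :=
  Nat.sInf_le (exists_flooding hn B d)

theorem reflTransGen_adjT (p q : Tile n) : Relation.ReflTransGen adjT p q := by
  obtain ⟨N, hN⟩ : ∃ N, ((p.1 : ℤ) - (q.1 : ℤ)).natAbs + ((p.2 : ℤ) - (q.2 : ℤ)).natAbs = N :=
    ⟨_, rfl⟩
  induction N generalizing q with
  | zero =>
    obtain rfl : p = q := by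
      ext <;> omega
    exact Relation.ReflTransGen.refl
  | succ N ih =>
    obtain ⟨p₁, p₂⟩ := p
    obtain ⟨q₁, q₂⟩ := q
    simp only at hN ih
    rcases Nat.lt_trichotomy p₁ q₁ with h | h | h
    · refine (ih (⟨q₁ - 1, by omega⟩, q₂) ?_).tail ?_
      · simp only; omega
      · simp only [adjT]; omega
    · rcases Nat.lt_or_ge p₂ q₂ with h' | h'
      · refine (ih (q₁, ⟨q₂ - 1, by omega⟩) ?_).tail ?_
        · simp only; omega
        · simp only [adjT]; omega
      · refine (ih (q₁, ⟨q₂ + 1, by omega⟩) ?_).tail ?_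
        · simp only; omega
        · simp only [adjT]; omega
    · refine (ih (⟨q₁ + 1, by omega⟩, q₂) ?_).tail ?_
      · simp only; omega
      · simp only [adjT]; omega

theorem Flooded.conn (h : Flooded B) (p q : Tile n) : SameColorConn B p q :=
  Relation.ReflTransGen.mono (fun a b hab => ⟨hab, h a b⟩) _ _ (reflTransGen_adjT p q)

/-- A family of potentials on tiles, each of which can only be lowered by the moves whose colour
belongs to it, and then by at most one, bounds the number of moves from below. -/
theorem sum_le_length_of_flooded {m s : ℕ} (Φ : Fin m → Tile n → ℕ) (z : Fin m → Tile n)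
    (g : Fin c → ℕ) (hz : ∀ i, Φ i (z i) = 0) (hs : ∀ i q, Φ i q ≤ s)
    (hlip : ∀ i p q, adjT p q → Φ i p ≤ Φ i q + 1)
    (hcomp : ∀ i p q, adjT p q → B p = B q → Φ i p = Φ i q)
    (hg : ∀ (i : Fin m) q, g (B q) ≠ i → Φ i q = s)
    (ms : List (Fin c)) (hB' : AgreeOutside o B B') (L : Fin m → ℕ)
    (hL : ∀ i q, SameColorConn B' o q → L i ≤ Φ i q)
    (hfl : Flooded (playMoves o B' ms)) : ∑ i, L i ≤ ms.length := by
  induction ms generalizing B' L with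
  | nil =>
    refine (Finset.sum_eq_zero fun i _ => ?_).le
    exact Nat.le_zero.1 (hz i ▸ hL i (z i) (hfl.conn o (z i)))
  | cons k ks ih =>
    have key : ∀ q, SameColorConn (flood B' o k) o q → SameColorConn B' o q ∨
        (B q = k ∧ ∃ r, SameColorConn B' o r ∧ ∃ q₀, adjT r q₀ ∧ ∀ i, Φ i q = Φ i q₀) := by
      intro q hq
      induction hq with
      | refl => exact Or.inl Relation.ReflTransGen.refl
      | @tail a b hoa hab iha =>
        by_cases hb : SameColorConn B' o b
        · exact Or.inl hb
        right
        have hbk : B b = k := by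
          have h₁ := SameColorConn.eq_color (Relation.ReflTransGen.tail hoa hab)
          rw [flood_of_conn k (Relation.ReflTransGen.refl : SameColorConn B' o o),
            flood_of_not_conn k hb, hB' b hb] at h₁
          exact h₁.symm
        refine ⟨hbk, ?_⟩
        rcases iha with ha | ⟨hak, r, hr, q₀, hrq, hΦ⟩
        · exact ⟨a, ha, b, hab.1, fun _ => rfl⟩
        · exact ⟨r, hr, q₀, hrq, fun i =>
            (hcomp i a b hab.1 (hak.trans hbk.symm)).symm.trans (hΦ i)⟩
    have hstep := ih (hB'.flood k) (fun i => if g k = i then L i - 1 else L i) (by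
      intro i q hq
      rcases key q hq with hq | ⟨hqk, r, hr, q₀, hrq, hΦ⟩
      · have := hL i q hq
        split_ifs <;> omega
      · have h₁ := hL i r hr
        have h₂ := hlip i r q₀ hrq
        have h₃ := hs i r
        have h₄ := hΦ i
        split_ifs with hgk
        · omega
        · have := hg i q (by rwa [hqk])
          omega) hfl
    have hsum : ∑ i, L i ≤ ∑ i : Fin m, (if g k = i then L i - 1 else L i) + 1 := by
      by_cases hk : g k < m
      · have hrest : ∑ i ∈ Finset.univ.erase (⟨g k, hk⟩ : Fin m), L i =
            ∑ i ∈ Finset.univ.erase (⟨g k, hk⟩ : Fin m), (if g k = i then L i - 1 else L i) := by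
          refine Finset.sum_congr rfl fun i hi => ?_
          rw [if_neg]
          exact fun h => Finset.ne_of_mem_erase hi (Fin.ext h.symm)
        rw [← Finset.add_sum_erase _ _ (Finset.mem_univ (⟨g k, hk⟩ : Fin m)),
          ← Finset.add_sum_erase _ (fun i : Fin m => if g k = i then L i - 1 else L i)
            (Finset.mem_univ (⟨g k, hk⟩ : Fin m)), hrest]
        simp only [if_true]
        omega
      · refine Nat.le_succ_of_le (Finset.sum_le_sum fun i _ => ?_)
        rw [if_neg (by have := i.2; omega)]
    simp only [List.length_cons]
    omega

end Flooding

/-- The `ℓ¹` distance between two tiles. -/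
def tileDist {n : ℕ} (p q : Tile n) : ℕ :=
  ((p.1 : ℤ) - (q.1 : ℤ)).natAbs + ((p.2 : ℤ) - (q.2 : ℤ)).natAbs

/-- The lattice of points whose coordinate sum and difference are divisible by `2 * s` has minimal
`ℓ¹` distance `2 * s`; some translate of it meets the board in more than `m` tiles. -/
theorem exists_separated {n m s : ℕ} (hs : 0 < s) (h : 2 * m * s ^ 2 < n ^ 2) :
    ∃ F : Finset (Tile n), m < F.card ∧ ∀ p ∈ F, ∀ q ∈ F, p ≠ q → 2 * s ≤ tileDist p q := by
  let key : Tile n → ℕ × ℕ := fun p => ((p.1 + p.2) % (2 * s), p.1 % s)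
  obtain ⟨y, -, hy⟩ := Finset.exists_lt_card_fiber_of_mul_lt_card_of_maps_to
    (s := (Finset.univ : Finset (Tile n)))
    (t := Finset.range (2 * s) ×ˢ Finset.range s) (f := key) (n := m)
    (by
      intro p _
      simp only [key, Finset.mem_product, Finset.mem_range]
      exact ⟨Nat.mod_lt _ (by omega), Nat.mod_lt _ hs⟩)
    (by
      simp only [Finset.card_product, Finset.card_range, Finset.card_univ, Fintype.card_prod,
        Fintype.card_fin]
      nlinarith)
  refine ⟨_, hy, ?_⟩
  rintro ⟨p₁, p₂⟩ hp ⟨q₁, q₂⟩ hq hpq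
  have hkey : key (p₁, p₂) = key (q₁, q₂) :=
    (Finset.mem_filter.1 hp).2.trans (Finset.mem_filter.1 hq).2.symm
  simp only [key, Prod.mk.injEq] at hkey
  obtain ⟨a, ha⟩ := (Nat.modEq_iff_dvd.1 (show (p₁ + p₂ : ℕ) ≡ q₁ + q₂ [MOD 2 * s] from hkey.1))
  obtain ⟨b, hb⟩ := (Nat.modEq_iff_dvd.1 (show (p₁ : ℕ) ≡ q₁ [MOD s] from hkey.2))
  push_cast at ha
  have hdiff : ((q₁ : ℤ) - q₂) - (p₁ - p₂) = 2 * s * (b - a) := by linarith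
  have hs' : (0 : ℤ) < s := by exact_mod_cast hs
  simp only [tileDist]
  by_contra hlt
  have ha0 : a = 0 := by
    have h₁ : |2 * (s : ℤ) * a| < 2 * s * 1 := by rw [← ha, abs_lt]; omega
    rw [abs_mul, abs_of_pos (by linarith : (0 : ℤ) < 2 * s)] at h₁
    exact Int.abs_lt_one_iff.1 (lt_of_mul_lt_mul_left h₁ (by linarith))
  have hb0 : b - a = 0 := by
    have h₁ : |2 * (s : ℤ) * (b - a)| < 2 * s * 1 := by rw [← hdiff, abs_lt]; omega
    rw [abs_mul, abs_of_pos (by linarith : (0 : ℤ) < 2 * s)] at h₁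
    exact Int.abs_lt_one_iff.1 (lt_of_mul_lt_mul_left h₁ (by linarith))
  rw [ha0, mul_zero] at ha
  rw [hb0, mul_zero] at hdiff
  apply hpq
  simp only [Prod.mk.injEq, Fin.ext_iff]
  omega

theorem exists_separated_away {n m s : ℕ} (hs : 0 < s) (h : 2 * m * s ^ 2 < n ^ 2) (o : Tile n) :
    ∃ z : Fin m → Tile n, (∀ i, s ≤ tileDist o (z i)) ∧
      ∀ i j, i ≠ j → 2 * s ≤ tileDist (z i) (z j) := by
  obtain ⟨F, hF, hsep⟩ := exists_separated hs h
  have hnear : (F.filter fun p => tileDist o p < s).card ≤ 1 := by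
    refine Finset.card_le_one.2 fun p hp q hq => ?_
    rw [Finset.mem_filter] at hp hq
    by_contra hpq
    have h₁ := hsep p hp.1 q hq.1 hpq
    have h₂ := hp.2
    have h₃ := hq.2
    simp only [tileDist] at h₁ h₂ h₃
    omega
  have hfar : m ≤ (F.filter fun p => ¬ tileDist o p < s).card := by
    have := Finset.card_filter_add_card_filter_not (s := F) (fun p => tileDist o p < s)
    omega
  obtain ⟨G, hG, hGc⟩ := Finset.exists_subset_card_eq hfar
  let e := (G.equivFinOfCardEq hGc).symm
  refine ⟨fun i => e i, fun i => ?_, fun i j hij => ?_⟩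
  · exact not_lt.1 (Finset.mem_filter.1 (hG (e i).2)).2
  · exact hsep _ (Finset.mem_filter.1 (hG (e i).2)).1 _ (Finset.mem_filter.1 (hG (e j).2)).1
      fun h' => hij (e.injective (Subtype.ext h'))

/-- A board containing `m` disjoint diamonds of concentric rings, each diamond alternating between
two colours of its own, needs `m * s` moves. -/
theorem exists_board_mul_le {n c m s : ℕ} (hn : 0 < n) (hm : 0 < m) (hmc : 2 * m ≤ c)
    (h : 2 * m * s ^ 2 < n ^ 2) :
    ∃ B : Board n c, m * s ≤ floodMoves B (⟨0, hn⟩, ⟨0, hn⟩) := by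
  classical
  rcases Nat.eq_zero_or_pos s with rfl | hs
  · exact ⟨fun _ => ⟨0, by omega⟩, by simp⟩
  set o : Tile n := (⟨0, hn⟩, ⟨0, hn⟩)
  obtain ⟨z, hzo, hzz⟩ := exists_separated_away hs h o
  let Φ : Fin m → Tile n → ℕ := fun i q => min s (tileDist q (z i))
  let idx : Tile n → Fin m := fun q =>
    if hq : ∃ i, tileDist q (z i) < s then hq.choose else ⟨0, hm⟩
  let B : Board n c := fun q => ⟨2 * (idx q : ℕ) + Φ (idx q) q % 2, by omega⟩
  have hidx : ∀ i q, idx q ≠ i → Φ i q = s := by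
    intro i q hi
    refine min_eq_left (not_lt.1 fun hlt => hi ?_)
    have hex : ∃ i, tileDist q (z i) < s := ⟨i, hlt⟩
    have hch : tileDist q (z (idx q)) < s := by
      simp only [idx, dif_pos hex]
      exact hex.choose_spec
    by_contra hne
    have h₁ := hzz _ _ hne
    simp only [tileDist] at h₁ hch hlt
    omega
  have hlip : ∀ i p q, adjT p q → Φ i p ≤ Φ i q + 1 := by
    intro i p q hpq
    simp only [adjT] at hpq
    simp only [Φ, tileDist]
    omega
  have hsymm : ∀ p q : Tile n, adjT p q → adjT q p := by
    intro p q hpq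
    simp only [adjT] at hpq ⊢
    omega
  refine ⟨B, le_csInf ⟨_, exists_flooding hn B 0⟩ ?_⟩
  rintro l ⟨ms, rfl, hfl⟩
  have hcomp : ∀ i p q, adjT p q → B p = B q → Φ i p = Φ i q := by
    intro i p q hpq hB
    simp only [B, Fin.mk.injEq] at hB
    have heq : idx p = idx q := by
      apply Fin.ext
      omega
    rw [heq] at hB
    by_cases hi : idx q = i
    · subst hi
      have h₁ := hlip (idx q) p q hpq
      have h₂ := hlip (idx q) q p (hsymm p q hpq)
      omega
    · rw [hidx i q hi, hidx i p (heq ▸ hi)]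
  have hsum := sum_le_length_of_flooded (B := B) (s := s) Φ z (fun k => k / 2)
    (fun i => by simp [Φ, tileDist]) (fun i q => min_le_left _ _) hlip hcomp
    (fun i q hq => hidx i q fun hi => hq (by simp only [B, ← hi]; omega))
    ms (AgreeOutside.refl o B) (fun _ => s) (by
      intro i q hq
      induction hq with
      | refl => exact le_min le_rfl (hzo i)
      | tail _ hab ih => exact ih.trans (hcomp i _ _ hab.1 hab.2).le) hfl
  simpa using hsum

theorem exists_max_scale {n m : ℕ} (hn : 0 < n) (hm : 0 < m) :
    ∃ s, 2 * m * s ^ 2 < n ^ 2 ∧ n ^ 2 ≤ 2 * m * (s + 1) ^ 2 := by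
  have hn2 : 0 < n ^ 2 := by positivity
  refine ⟨Nat.sqrt ((n ^ 2 - 1) / (2 * m)), ?_, ?_⟩
  · have h₁ := Nat.sqrt_le' ((n ^ 2 - 1) / (2 * m))
    have h₂ := Nat.mul_le_mul_left (2 * m) h₁
    have h₃ := Nat.mul_div_le (n ^ 2 - 1) (2 * m)
    omega
  · have h₁ := Nat.lt_succ_sqrt' ((n ^ 2 - 1) / (2 * m))
    rw [Nat.div_lt_iff_lt_mul (by omega), Nat.mul_comm] at h₁
    have : 2 * m * (Nat.sqrt ((n ^ 2 - 1) / (2 * m)) + 1) ^ 2 =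
        2 * m * (Nat.sqrt ((n ^ 2 - 1) / (2 * m))).succ ^ 2 := rfl
    omega

/-- for 2 ≤ c ≤ n², the maximum of m(B) over all n×n boards with at
most c colours satisfies (√(c-1)·n − c)/2 ≤ max m(B) ≤ 2n + √(2c)·n + c
(so this maximum is Θ(√c · n)). -/
theorem stmt12 (n c : ℕ) (hn : 1 ≤ n) (hc : 2 ≤ c) (hcn : c ≤ n ^ 2) :
    (Real.sqrt ((c : ℝ) - 1) * n - c) / 2
        ≤ (((Finset.univ.sup fun B : Board n c => floodMoves B (⟨0, hn⟩, ⟨0, hn⟩)) : ℕ) : ℝ) ∧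
      (((Finset.univ.sup fun B : Board n c => floodMoves B (⟨0, hn⟩, ⟨0, hn⟩)) : ℕ) : ℝ)
        ≤ 2 * n + Real.sqrt (2 * c) * n + c := by
  constructor
  · have hm : 0 < c / 2 := by omega
    obtain ⟨s, hs, hs'⟩ := exists_max_scale hn hm
    obtain ⟨B, hB⟩ := exists_board_mul_le (c := c) hn hm (by omega) hs
    have hsup : c / 2 * s ≤ Finset.univ.sup fun B : Board n c =>
        floodMoves B (⟨0, hn⟩, ⟨0, hn⟩) :=
      hB.trans (Finset.le_sup (f := fun B : Board n c => floodMoves B (⟨0, hn⟩, ⟨0, hn⟩))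
        (Finset.mem_univ B))
    refine le_trans ?_ (Nat.cast_le.2 hsup)
    have hc₁ : (c : ℝ) - 1 ≤ 2 * ((c / 2 : ℕ) : ℝ) := by
      rw [sub_le_iff_le_add]
      exact_mod_cast (by omega : c ≤ 2 * (c / 2) + 1)
    have hc₂ : 2 * ((c / 2 : ℕ) : ℝ) ≤ c := by
      exact_mod_cast (by omega : 2 * (c / 2) ≤ c)
    have hs'' : (n : ℝ) ^ 2 ≤ 2 * ((c / 2 : ℕ) : ℝ) * (s + 1) ^ 2 := by exact_mod_cast hs'
    push_cast
    generalize ((c / 2 : ℕ) : ℝ) = m at *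
    have hc0 : (0 : ℝ) ≤ (c : ℝ) - 1 := by
      have : (2 : ℝ) ≤ c := by exact_mod_cast hc
      linarith
    have hm0 : 0 ≤ 2 * m := hc0.trans hc₁
    have key : Real.sqrt ((c : ℝ) - 1) * n ≤ 2 * m * (s + 1) := by
      refine abs_le_of_sq_le_sq' ?_ (by positivity) |>.2
      rw [mul_pow, Real.sq_sqrt hc0, mul_pow, sq (2 * m), mul_assoc]
      exact mul_le_mul hc₁ hs'' (by positivity) hm0
    linarith
  · have hn0 : (0 : ℝ) < n := by exact_mod_cast hn
    have hc0 : (0 : ℝ) < c := by exact_mod_cast (by omega : 0 < c)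
    set r := Real.sqrt (2 * c) with hr
    have hr0 : 0 < r := Real.sqrt_pos.2 (by positivity)
    have hr2 : r * r = 2 * c := Real.mul_self_sqrt (by positivity)
    set d := ⌈(n : ℝ) / r⌉₊ with hd
    have hd₁ : (n : ℝ) ≤ d * r := (div_le_iff₀ hr0).1 (Nat.le_ceil _)
    have hd₂ : (d : ℝ) * c ≤ r / 2 * n + c := by
      have h₁ : (d : ℝ) ≤ n / r + 1 := (Nat.ceil_lt_add_one (by positivity)).le
      calc (d : ℝ) * c ≤ (n / r + 1) * c := by gcongr
        _ = (n / r + 1) * (r * r / 2) := by rw [hr2]; ring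
        _ = r / 2 * n + r * r / 2 := by field_simp
        _ = r / 2 * n + c := by rw [hr2]; ring
    have hrows : ((n / (2 * d + 1) : ℕ) : ℝ) ≤ r / 2 := by
      refine Nat.cast_div_le.trans ?_
      push_cast
      rw [div_le_iff₀ (by positivity)]
      nlinarith
    have hsup : (Finset.univ.sup fun B : Board n c => floodMoves B (⟨0, hn⟩, ⟨0, hn⟩)) ≤
        n + (n / (2 * d + 1) + 1) * n + d * c :=
      Finset.sup_le fun B _ => floodMoves_le hn B d
    refine (Nat.cast_le.2 hsup).trans ?_
    push_cast
    nlinarith
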